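/- arXiv:2205.15032 — 3 statements merged into one kernel-verified Lean document; each statement's English description precedes it below -/
import Mathlib

section
/- Let 1 ≤ p < n and let J⟶ and J⟵ be finite posets on {1,…,n} such that: (i) J⟶ and J⟵ induce the same partial order on {1,…,p}; (ii) in J⟶ the elements p ≺ p+1 ≺ ⋯ ≺ n form a chain, and for every i ≤ p and j > p one has i ⪯_{J⟶} j iff i ⪯_{J⟶} p, and never j ⪯_{J⟶} i; (iii) in J⟵ the elements form the reversed chain n ≺ n−1 ≺ ⋯ ≺ p+1 ≺ p, and for every i ≤ p and j > p one has j ⪯_{J⟵} i iff p ⪯_{J⟵} i, and never i ⪯_{J⟵} j. Then J⟶ and J⟵ are strongly Gram ℤ-congruent: there exists B ∈ M_n(ℤ) with det B = ±1 such that C_{J⟵} = Bᵀ · C_{J⟶} · B. -/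
open Matrix

open Classical in
/-- Incidence matrix `C_J ∈ M_n(ℤ)` of the poset given by relation `le` on `Fin n`. -/
noncomputable def inc (n : ℕ) (le : Fin n → Fin n → Prop) : Matrix (Fin n) (Fin n) ℤ :=
  Matrix.of fun i j => if le i j then 1 else 0

/-- The reversal of the tail `{p + 1, …, n - 1}` of `Fin n`, fixing all `j ≤ p`. -/
def tailReverse {n : ℕ} (p j : Fin n) : Fin n :=
  if h : j ≤ p then j else ⟨n + p - j, by have := j.isLt; rw [Fin.le_def] at h; omega⟩

theorem tailReverse_val {n : ℕ} {p j : Fin n} (h : p < j) :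
    (tailReverse p j : ℕ) = n + p - j := by
  simp [tailReverse, h.not_ge]

theorem lt_tailReverse {n : ℕ} {p j : Fin n} (h : p < j) : p < tailReverse p j := by
  rw [Fin.lt_def, tailReverse_val h]
  omega

theorem tailReverse_tailReverse {n : ℕ} {p j : Fin n} (h : p < j) :
    tailReverse p (tailReverse p j) = j := by
  rw [Fin.ext_iff, tailReverse_val (lt_tailReverse h), tailReverse_val h]
  omega

theorem tailReverse_le_tailReverse {n : ℕ} {p i j : Fin n} (hi : p < i) (hj : p < j) :
    tailReverse p i ≤ tailReverse p j ↔ j ≤ i := by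
  rw [Fin.le_def, Fin.le_def, tailReverse_val hi, tailReverse_val hj]
  omega

/-- The matrix with columns `e_j` for `j ≤ p` and `e_p - e_{tailReverse p j}` for `j > p`. -/
def pathReflection {n : ℕ} (p : Fin n) : Matrix (Fin n) (Fin n) ℤ :=
  Matrix.of fun k j =>
    if j ≤ p then (1 : Matrix (Fin n) (Fin n) ℤ) k j
    else (1 : Matrix (Fin n) (Fin n) ℤ) k p - (1 : Matrix (Fin n) (Fin n) ℤ) k (tailReverse p j)

theorem mul_pathReflection_apply {n : ℕ} (p : Fin n) (A : Matrix (Fin n) (Fin n) ℤ)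
    (i j : Fin n) :
    (A * pathReflection p) i j = if j ≤ p then A i j else A i p - A i (tailReverse p j) := by
  split_ifs with h <;>
    simp [Matrix.mul_apply, pathReflection, h, Matrix.one_apply, mul_sub, Finset.sum_sub_distrib]

theorem transpose_pathReflection_mul_apply {n : ℕ} (p : Fin n) (A : Matrix (Fin n) (Fin n) ℤ)
    (i j : Fin n) :
    ((pathReflection p)ᵀ * A) i j = if i ≤ p then A i j else A p j - A (tailReverse p i) j := by
  rw [← Matrix.transpose_apply ((pathReflection p)ᵀ * A), Matrix.transpose_mul,
    Matrix.transpose_transpose, mul_pathReflection_apply]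
  simp only [Matrix.transpose_apply]

theorem pathReflection_mul_self {n : ℕ} (p : Fin n) :
    pathReflection p * pathReflection p = 1 := by
  ext i j
  rw [mul_pathReflection_apply]
  split_ifs with h
  · simp [pathReflection, h]
  · rw [not_le] at h
    simp only [pathReflection, Matrix.of_apply, le_refl, if_true, (lt_tailReverse h).not_ge,
      if_false, sub_sub_cancel]
    rw [tailReverse_tailReverse h]

theorem det_pathReflection {n : ℕ} (p : Fin n) :
    (pathReflection p).det = 1 ∨ (pathReflection p).det = -1 := by
  rw [← mul_self_eq_one_iff, ← Matrix.det_mul, pathReflection_mul_self, Matrix.det_one]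

/-- Let `J⟶` (relation `le₁`) and `J⟵` (relation `le₂`) be posets on
`{1,…,n}` (here `Fin n`, with `p` not the last element) agreeing on `{1,…,p}`, such that in
`J⟶` the elements `p ≺ p+1 ≺ ⋯ ≺ n` form an outward `p`-anchored chain (every `i ≤ p` is below
`j > p` exactly when `i ⪯ p`, and never above), while in `J⟵` the chain is reversed
(`n ≺ ⋯ ≺ p`, every `j > p` is below `i ≤ p` exactly when `p ⪯ i`, and never above). Then `J⟶`
and `J⟵` are strongly Gram ℤ-congruent: `C_{J⟵} = Bᵀ · C_{J⟶} · B` for some `B ∈ M_n(ℤ)` with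
`det B = ±1`. -/
theorem anchored_path_reflection_strong_congruence (n : ℕ) (p : Fin n)
    (hp : (p : ℕ) < n - 1)
    (le₁ le₂ : Fin n → Fin n → Prop)
    (hpo₁ : IsPartialOrder (Fin n) le₁) (hpo₂ : IsPartialOrder (Fin n) le₂)
    (hsame : ∀ i j : Fin n, i ≤ p → j ≤ p → (le₁ i j ↔ le₂ i j))
    (hchain₁ : ∀ i j : Fin n, p ≤ i → p ≤ j → (le₁ i j ↔ i ≤ j))
    (hanchor₁ : ∀ i j : Fin n, i ≤ p → p < j → ((le₁ i j ↔ le₁ i p) ∧ ¬ le₁ j i))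
    (hchain₂ : ∀ i j : Fin n, p ≤ i → p ≤ j → (le₂ i j ↔ j ≤ i))
    (hanchor₂ : ∀ i j : Fin n, i ≤ p → p < j → ((le₂ j i ↔ le₂ p i) ∧ ¬ le₂ i j)) :
    ∃ B : Matrix (Fin n) (Fin n) ℤ, (B.det = 1 ∨ B.det = -1) ∧
      inc n le₂ = Bᵀ * inc n le₁ * B := by
  classical
  refine ⟨pathReflection p, det_pathReflection p, ?_⟩
  ext i j
  have refl_p : le₁ p p := (hchain₁ p p le_rfl le_rfl).2 le_rfl
  rw [mul_pathReflection_apply]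
  simp only [transpose_pathReflection_mul_apply]
  simp only [inc, Matrix.of_apply]
  rcases le_or_gt i p with hi | hi <;> rcases le_or_gt j p with hj | hj
  · simp [hi, hj, hsame i j hi hj]
  · simp [hi, hj.not_ge, (hanchor₂ i j hi hj).2, (hanchor₁ i _ hi (lt_tailReverse hj)).1]
  · simp [hi.not_ge, hj, (hanchor₂ j i hj hi).1, (hanchor₁ j _ hj (lt_tailReverse hi)).2,
      hsame p j le_rfl hj]
  · have hi' := lt_tailReverse hi
    have hj' := lt_tailReverse hj
    simp [hi.not_ge, hj.not_ge, refl_p, hchain₂ i j hi.le hj.le, hchain₁ _ _ hi'.le hj'.le,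
      (hanchor₁ p _ le_rfl hi').2, (hanchor₁ p _ le_rfl hj').1,
      tailReverse_le_tailReverse hi hj]
end

section
/- For n ≥ 3, the number N(C_n) of isomorphism classes of directed graphs whose underlying undirected graph is the cycle graph on n vertices equals (1/(2n)) · Σ_{d | n} 2^{n/d} · φ(d) if n is odd, and (1/(2n)) · Σ_{d | n} 2^{n/d} · φ(d) + 2^{n/2 − 2} if n is even, where φ is Euler's totient function. -/
/-- Two digraphs (arc relations) on `Fin n` are isomorphic if some bijection of the vertices
carries the arcs of one onto the arcs of the other. -/
def DigraphIso (n : ℕ) (A B : Fin n → Fin n → Prop) : Prop :=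
  ∃ σ : Equiv.Perm (Fin n), ∀ a b, A a b ↔ B (σ a) (σ b)

theorem digraphIso_equivalence (n : ℕ) : Equivalence (DigraphIso n) := by
  constructor
  · exact fun A => ⟨Equiv.refl _, fun a b => Iff.rfl⟩
  · rintro A B ⟨σ, hσ⟩
    exact ⟨σ.symm, fun a b => by simpa using (hσ (σ.symm a) (σ.symm b)).symm⟩
  · rintro A B C ⟨σ, hσ⟩ ⟨τ, hτ⟩
    exact ⟨σ.trans τ, fun a b => (hσ a b).trans (hτ (σ a) (σ b))⟩

/-- A digraph on `Fin n` is an orientation of the cycle graph on `n` vertices: its underlying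
undirected graph is the cycle graph, each edge carrying exactly one direction. -/
def IsCycleOrientation (n : ℕ) (A : Fin n → Fin n → Prop) : Prop :=
  (∀ a b, (A a b ∨ A b a) ↔ (SimpleGraph.cycleGraph n).Adj a b) ∧
    ∀ a b, A a b → ¬ A b a

/-- The setoid of orientations of the cycle graph on `n` vertices, up to digraph
isomorphism. -/
def cycleOrientSetoid (n : ℕ) : Setoid {A : Fin n → Fin n → Prop // IsCycleOrientation n A} :=
  ⟨fun A B => DigraphIso n A.1 B.1,
    ⟨fun A => (digraphIso_equivalence n).refl A.1,
      fun h => (digraphIso_equivalence n).symm h,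
      fun h g => (digraphIso_equivalence n).trans h g⟩⟩

/-- The dihedral group acts on the `Bool`-labellings of the edges of a cycle: rotations translate
the labels, while reflections reverse the cycle and negate the labels. -/
instance dihedralLabellingAction (n : ℕ) : MulAction (DihedralGroup n) (ZMod n → Bool) where
  smul g f := match g with
    | .r k => fun x => f (x - k)
    | .sr k => fun x => !f (-k - x)
  one_smul f := funext fun x => congrArg f (sub_zero x)
  mul_smul g h f := by
    funext x
    rcases g with i | i <;> rcases h with j | j
    · exact congrArg f (by ring)
    · exact congrArg (fun y => !f y) (by ring)
    · exact congrArg (fun y => !f y) (by ring)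
    · refine Eq.trans (congrArg f ?_) (Bool.not_not _).symm
      ring

theorem r_smul_labelling {n : ℕ} (k : ZMod n) (f : ZMod n → Bool) (x : ZMod n) :
    (DihedralGroup.r k • f) x = f (x - k) := rfl

theorem sr_smul_labelling {n : ℕ} (k : ZMod n) (f : ZMod n → Bool) (x : ZMod n) :
    (DihedralGroup.sr k • f) x = !f (-k - x) := rfl

/-- Functions with period `c` are functions on the quotient by the multiples of `c`. -/
def periodicEquivQuotient {α β : Type*} [AddCommGroup α] (c : α) :
    {f : α → β // Function.Periodic f c} ≃ (α ⧸ AddSubgroup.zmultiples c → β) where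
  toFun f := f.2.lift
  invFun g := ⟨fun x => g x, fun x => congrArg g (QuotientAddGroup.eq.2 (by simp))⟩
  left_inv f := rfl
  right_inv g := funext fun x => QuotientAddGroup.induction_on x fun _ => rfl

theorem card_periodic_bool {n : ℕ} [NeZero n] (k : ZMod n) :
    Nat.card {f : ZMod n → Bool // Function.Periodic f k} = 2 ^ (n / addOrderOf k) := by
  rw [Nat.card_congr (periodicEquivQuotient k), Nat.card_fun]
  have h := AddSubgroup.card_eq_card_quotient_mul_card_addSubgroup (AddSubgroup.zmultiples k)
  rw [Nat.card_zmultiples, Nat.card_zmod] at h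
  have hk : 0 < addOrderOf k := addOrderOf_pos k
  rw [Nat.div_eq_of_eq_mul_left hk h]
  simp

theorem sum_two_pow_div_addOrderOf (n : ℕ) [NeZero n] :
    ∑ k : ZMod n, 2 ^ (n / addOrderOf k) = ∑ d ∈ n.divisors, 2 ^ (n / d) * Nat.totient d := by
  rw [← Finset.sum_fiberwise_of_maps_to (s := Finset.univ) (t := n.divisors)
    (g := fun k : ZMod n => addOrderOf k)]
  · refine Finset.sum_congr rfl fun d hd => ?_
    rw [Finset.sum_congr rfl fun k hk => by rw [(Finset.mem_filter.1 hk).2], Finset.sum_const,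
      IsAddCyclic.card_addOrderOf_eq_totient
        (by rw [ZMod.card]; exact Nat.dvd_of_mem_divisors hd), smul_eq_mul, mul_comm]
  · intro k _
    have h := addOrderOf_dvd_card (x := k)
    rw [ZMod.card] at h
    exact Nat.mem_divisors.2 ⟨h, NeZero.ne n⟩

/-- A function that is negated by a fixed-point-free involution is determined by its values on
the points that precede their image. -/
def antiInvariantEquiv {α : Type*} (v : α → ℕ) (hv : Function.Injective v) (τ : α → α)
    (hτ : Function.Involutive τ) (hfix : ∀ x, τ x ≠ x) :
    {f : α → Bool // ∀ x, f x = !f (τ x)} ≃ ({x // v x < v (τ x)} → Bool) where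
  toFun f x := f.1 x
  invFun g := ⟨fun x => if h : v x < v (τ x) then g ⟨x, h⟩ else
      !g ⟨τ x, by rw [hτ x]; exact lt_of_le_of_ne (not_lt.1 h) fun e => hfix x (hv e)⟩, by
    intro x
    have hne : v (τ x) ≠ v x := fun e => hfix x (hv e)
    by_cases h : v x < v (τ x)
    · simp [h, hτ x, h.not_gt]
    · have h' : v (τ x) < v x := by omega
      simp [h, hτ x, h']⟩
  left_inv f := by
    ext x
    by_cases h : v x < v (τ x)
    · simp [h]
    · simp [h, ← f.2 x]
  right_inv g := by
    funext x
    simp [x.2]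

theorem two_mul_card_lt_involution {α : Type*} [Finite α] (v : α → ℕ) (hv : Function.Injective v)
    (τ : α → α) (hτ : Function.Involutive τ) (hfix : ∀ x, τ x ≠ x) :
    2 * Nat.card {x // v x < v (τ x)} = Nat.card α := by
  have e : {x // v x < v (τ x)} ≃ {x // ¬ v x < v (τ x)} :=
    hτ.toPerm.subtypeEquiv fun x => by
      have hne : v (τ x) ≠ v x := fun e => hfix x (hv e)
      simp only [Function.Involutive.coe_toPerm, hτ x]
      omega
  classical
  rw [← Nat.card_congr (Equiv.sumCompl fun x => v x < v (τ x)), Nat.card_sum, ← Nat.card_congr e,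
    two_mul]

theorem card_antiInvariant {n : ℕ} [NeZero n] (k : ZMod n) (hk : ∀ x, k - x ≠ x) :
    Nat.card {f : ZMod n → Bool // ∀ x, f x = !f (k - x)} = 2 ^ (n / 2) := by
  have hτ : Function.Involutive fun x => k - x := fun x => sub_sub_cancel k x
  rw [Nat.card_congr (antiInvariantEquiv ZMod.val (ZMod.val_injective n) _ hτ hk), Nat.card_fun]
  have h := two_mul_card_lt_involution ZMod.val (ZMod.val_injective n) _ hτ hk
  rw [Nat.card_zmod] at h
  rw [Nat.div_eq_of_eq_mul_right two_pos h.symm]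
  simp

theorem card_antiInvariant_eq_zero {n : ℕ} (k x : ZMod n) (hx : k - x = x) :
    Nat.card {f : ZMod n → Bool // ∀ x, f x = !f (k - x)} = 0 := by
  have : IsEmpty {f : ZMod n → Bool // ∀ x, f x = !f (k - x)} :=
    ⟨fun f => by simpa [hx] using f.2 x⟩
  exact Nat.card_of_isEmpty

theorem sum_card_antiInvariant_odd (n : ℕ) [NeZero n] (hn : Odd n) :
    ∑ k : ZMod n, Nat.card {f : ZMod n → Bool // ∀ x, f x = !f (k - x)} = 0 := by
  obtain ⟨m, rfl⟩ := hn
  refine Finset.sum_eq_zero fun k _ => card_antiInvariant_eq_zero k ((m + 1) * k) ?_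
  have h : ((2 * m + 1 : ℕ) : ZMod (2 * m + 1)) = 0 := ZMod.natCast_self _
  push_cast at h
  linear_combination (-k) * h

theorem exists_sub_eq_self_iff_castHom {n : ℕ} [NeZero n] (h2 : 2 ∣ n) (k : ZMod n) :
    (∃ x, k - x = x) ↔ ZMod.castHom h2 (ZMod 2) k = 0 := by
  constructor
  · rintro ⟨x, hx⟩
    rw [sub_eq_iff_eq_add.1 hx, map_add]
    exact CharTwo.add_self_eq_zero _
  · intro h
    rw [← ZMod.natCast_zmod_val k, map_natCast, ZMod.natCast_eq_zero_iff] at h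
    obtain ⟨j, hj⟩ := h
    refine ⟨j, ?_⟩
    rw [← ZMod.natCast_zmod_val k, hj]
    push_cast
    ring

theorem sum_card_antiInvariant_even (n : ℕ) [NeZero n] (hn : Even n) :
    ∑ k : ZMod n, Nat.card {f : ZMod n → Bool // ∀ x, f x = !f (k - x)} =
      n / 2 * 2 ^ (n / 2) := by
  classical
  have h2 : 2 ∣ n := hn.two_dvd
  let c := ZMod.castHom h2 (ZMod 2)
  have hsum : ∀ k : ZMod n, Nat.card {f : ZMod n → Bool // ∀ x, f x = !f (k - x)} =
      if c k = 0 then 0 else 2 ^ (n / 2) := by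
    intro k
    split_ifs with h
    · obtain ⟨x, hx⟩ := (exists_sub_eq_self_iff_castHom h2 k).2 h
      exact card_antiInvariant_eq_zero k x hx
    · exact card_antiInvariant k fun x hx => h ((exists_sub_eq_self_iff_castHom h2 k).1 ⟨x, hx⟩)
  have hshift : ∀ k, c k = 0 ↔ ¬ c (k + 1) = 0 := by
    intro k
    rw [map_add, map_one]
    generalize c k = y
    revert y
    decide
  have hcard : (Finset.univ.filter fun k => c k = 0).card =
      (Finset.univ.filter fun k => ¬ c k = 0).card :=
    Finset.card_equiv (Equiv.addRight 1) fun k => by simpa using hshift k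
  have htot := Finset.card_filter_add_card_filter_not (s := Finset.univ) (fun k => c k = 0)
  rw [Finset.card_univ, ZMod.card] at htot
  simp only [hsum]
  rw [Finset.sum_ite, Finset.sum_const_zero, zero_add, Finset.sum_const, smul_eq_mul]
  congr 1
  omega

theorem two_mul_card_orbits (n : ℕ) [NeZero n] :
    2 * n * Nat.card (MulAction.orbitRel.Quotient (DihedralGroup n) (ZMod n → Bool)) =
      ∑ d ∈ n.divisors, 2 ^ (n / d) * Nat.totient d +
        ∑ k : ZMod n, Nat.card {f : ZMod n → Bool // ∀ x, f x = !f (k - x)} := by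
  classical
  have hB := MulAction.sum_card_fixedBy_eq_card_orbits_mul_card_group
    (DihedralGroup n) (ZMod n → Bool)
  rw [DihedralGroup.card, ← Nat.card_eq_fintype_card, mul_comm] at hB
  refine hB.symm.trans ?_
  rw [Fintype.sum_equiv DihedralGroup.equivSum _
    (fun s => Fintype.card (MulAction.fixedBy (ZMod n → Bool) (DihedralGroup.equivSum.symm s)))
    (fun g => by cases g <;> rfl), Fintype.sum_sum_type, ← sum_two_pow_div_addOrderOf]
  congr 1
  · refine Finset.sum_congr rfl fun k _ => ?_
    rw [← card_periodic_bool, ← Nat.card_eq_fintype_card]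
    refine Nat.card_congr (Equiv.subtypeEquivRight fun f => ?_)
    rw [MulAction.mem_fixedBy, funext_iff]
    refine ⟨fun h x => ?_, fun h x => h.sub_eq x⟩
    have := h (x + k)
    exact (this.symm.trans (congrArg f (add_sub_cancel_right x k)))
  · refine Fintype.sum_equiv (Equiv.neg _) _ _ fun k => ?_
    rw [← Nat.card_eq_fintype_card]
    refine Nat.card_congr (Equiv.subtypeEquivRight fun f => ?_)
    rw [MulAction.mem_fixedBy, funext_iff]
    exact forall_congr' fun x => eq_comm

/-- The orientation of the cycle on `ZMod n` in which the edge between `x` and `x + 1` points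
forwards exactly when its label `f x` is `true`. -/
def cycleArcs {n : ℕ} (f : ZMod n → Bool) (x y : ZMod n) : Prop :=
  (y = x + 1 ∧ f x = true) ∨ (x = y + 1 ∧ f y = false)

theorem ZMod.two_ne_zero_of_three_le {n : ℕ} (hn : 3 ≤ n) : (2 : ZMod n) ≠ 0 := by
  intro h
  have h' : ((2 : ℕ) : ZMod n) = 0 := by exact_mod_cast h
  have := Nat.le_of_dvd two_pos ((ZMod.natCast_eq_zero_iff 2 n).1 h')
  omega

theorem ZMod.add_one_add_one_ne_self {n : ℕ} (hn : 3 ≤ n) (x : ZMod n) : x ≠ x + 1 + 1 := fun h =>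
  ZMod.two_ne_zero_of_three_le hn (by linear_combination -h)

theorem cycleArcs_or_swap {n : ℕ} (f : ZMod n → Bool) (x y : ZMod n) :
    cycleArcs f x y ∨ cycleArcs f y x ↔ y = x + 1 ∨ x = y + 1 := by
  unfold cycleArcs
  cases f x <;> cases f y <;> simp <;> tauto

theorem cycleArcs_add_one_right {n : ℕ} (hn : 3 ≤ n) (f : ZMod n → Bool) (x : ZMod n) :
    cycleArcs f x (x + 1) ↔ f x = true := by
  simp [cycleArcs, ZMod.add_one_add_one_ne_self hn x]

theorem cycleArcs_add_one_left {n : ℕ} (hn : 3 ≤ n) (f : ZMod n → Bool) (x : ZMod n) :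
    cycleArcs f (x + 1) x ↔ f x = false := by
  simp [cycleArcs, ZMod.add_one_add_one_ne_self hn x]

theorem cycleArcs_asymm {n : ℕ} (hn : 3 ≤ n) (f : ZMod n → Bool) (x y : ZMod n)
    (h : cycleArcs f x y) : ¬ cycleArcs f y x := by
  rcases h with ⟨rfl, h⟩ | ⟨rfl, h⟩
  · simp [cycleArcs_add_one_left hn, h]
  · simp [cycleArcs_add_one_right hn, h]

theorem cycleGraph_adj_finEquiv {n : ℕ} [NeZero n] (hn : 3 ≤ n) (a b : Fin n) :
    (SimpleGraph.cycleGraph n).Adj a b ↔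
      ZMod.finEquiv n b = ZMod.finEquiv n a + 1 ∨ ZMod.finEquiv n a = ZMod.finEquiv n b + 1 := by
  obtain ⟨m, rfl⟩ : ∃ m, n = m + 2 := ⟨n - 2, by omega⟩
  rw [SimpleGraph.cycleGraph_adj, sub_eq_iff_eq_add', sub_eq_iff_eq_add', or_comm]
  rw [← (ZMod.finEquiv (m + 2)).injective.eq_iff, ← (ZMod.finEquiv (m + 2)).injective.eq_iff,
    map_add, map_add, map_one]

/-- Orientations of the cycle graph correspond to `Bool`-labellings of its edges. -/
noncomputable def cycleOrientationEquiv (n : ℕ) [NeZero n] (hn : 3 ≤ n) :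
    (ZMod n → Bool) ≃ {A : Fin n → Fin n → Prop // IsCycleOrientation n A} where
  toFun f := ⟨fun a b => cycleArcs f (ZMod.finEquiv n a) (ZMod.finEquiv n b),
    fun a b => by rw [cycleArcs_or_swap, cycleGraph_adj_finEquiv hn],
    fun a b => cycleArcs_asymm hn f _ _⟩
  invFun A := fun x =>
    open Classical in decide (A.1 ((ZMod.finEquiv n).symm x) ((ZMod.finEquiv n).symm (x + 1)))
  left_inv f := by
    funext x
    simp [cycleArcs_add_one_right hn]
  right_inv A := by
    obtain ⟨A, hA, hasymm⟩ := A
    refine Subtype.ext (funext fun a => funext fun b => propext ?_)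
    obtain ⟨x, rfl⟩ := (ZMod.finEquiv n).symm.surjective a
    obtain ⟨y, rfl⟩ := (ZMod.finEquiv n).symm.surjective b
    have hxy := hA ((ZMod.finEquiv n).symm x) ((ZMod.finEquiv n).symm y)
    have hasymm' := hasymm ((ZMod.finEquiv n).symm x) ((ZMod.finEquiv n).symm y)
    rw [cycleGraph_adj_finEquiv hn] at hxy
    simp only [RingEquiv.apply_symm_apply] at hxy ⊢
    constructor
    · rintro (⟨rfl, h⟩ | ⟨rfl, h⟩)
      · simpa using h
      · have h' : ¬ A ((ZMod.finEquiv n).symm y) ((ZMod.finEquiv n).symm (y + 1)) := by simpa using h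
        tauto
    · intro h
      rcases hxy.1 (Or.inl h) with rfl | rfl
      · exact Or.inl ⟨rfl, by simpa using h⟩
      · exact Or.inr ⟨rfl, by simpa using hasymm' h⟩

theorem ZMod.eq_of_forall_add_one_eq {n : ℕ} {α : Type*} {f : ZMod n → α}
    (h : ∀ x, f (x + 1) = f x) (x : ZMod n) : f x = f 0 := by
  obtain ⟨z, rfl⟩ := ZMod.intCast_surjective x
  induction z using Int.induction_on with
  | zero => simp
  | succ i ih => push_cast at ih ⊢; rw [h, ih]
  | pred i ih => rw [← ih, ← h]; push_cast; rw [sub_add_cancel]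

/-- The automorphisms of a cycle are rotations and reflections. -/
theorem cycle_automorphism_eq_rotation_or_reflection {n : ℕ} (hn : 3 ≤ n) {σ : ZMod n → ZMod n}
    (hσ : Function.Injective σ) (h : ∀ x, σ (x + 1) = σ x + 1 ∨ σ x = σ (x + 1) + 1) :
    (∃ k, ∀ x, σ x = x + k) ∨ ∃ k, ∀ x, σ x = k - x := by
  have hstep : ∀ x, σ (x + 1 + 1) - σ (x + 1) = σ (x + 1) - σ x := by
    intro x
    have hne : σ (x + 1 + 1) ≠ σ x := fun e => ZMod.add_one_add_one_ne_self hn x (hσ e).symm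
    rcases h x with h1 | h1 <;> rcases h (x + 1) with h2 | h2
    · rw [h2, h1]; ring
    · exact absurd (add_right_cancel (h2.symm.trans h1)) hne
    · exact absurd (h2.trans h1.symm) hne
    · rw [h1, h2]; ring
  have hconst := ZMod.eq_of_forall_add_one_eq (f := fun x => σ (x + 1) - σ x) hstep
  rcases h 0 with h0 | h0
  · refine Or.inl ⟨σ 0, fun x => ?_⟩
    have := ZMod.eq_of_forall_add_one_eq (f := fun x => σ x - x)
      (fun x => by linear_combination hconst x + h0) x
    linear_combination this
  · refine Or.inr ⟨σ 0, fun x => ?_⟩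
    have := ZMod.eq_of_forall_add_one_eq (f := fun x => σ x + x)
      (fun x => by linear_combination hconst x - h0) x
    linear_combination this

theorem exists_perm_cycleArcs_iff {n : ℕ} (hn : 3 ≤ n) (f g : ZMod n → Bool) :
    (∃ σ : Equiv.Perm (ZMod n), ∀ x y, cycleArcs f x y ↔ cycleArcs g (σ x) (σ y)) ↔
      f ∈ MulAction.orbit (DihedralGroup n) g := by
  constructor
  · rintro ⟨σ, hσ⟩
    have hadj : ∀ x, σ (x + 1) = σ x + 1 ∨ σ x = σ (x + 1) + 1 := fun x => by
      rw [← cycleArcs_or_swap g, ← hσ, ← hσ, cycleArcs_or_swap]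
      exact Or.inl rfl
    rcases cycle_automorphism_eq_rotation_or_reflection hn σ.injective hadj with ⟨k, hk⟩ | ⟨k, hk⟩
    · refine ⟨.r (-k), funext fun x => Bool.eq_iff_iff.2 ?_⟩
      rw [← cycleArcs_add_one_right hn f x, hσ, hk, hk, add_right_comm,
        cycleArcs_add_one_right hn]
      simp [r_smul_labelling]
    · refine ⟨.sr (1 - k), funext fun x => Bool.eq_iff_iff.2 ?_⟩
      rw [← cycleArcs_add_one_right hn f x, hσ, hk, hk,
        show k - x = k - (x + 1) + 1 by ring, cycleArcs_add_one_left hn]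
      simp only [sr_smul_labelling, Bool.not_eq_true']
      rw [show -(1 - k) - x = k - (x + 1) by ring]
  · rintro ⟨k | k, rfl⟩
    · refine ⟨Equiv.subRight k, fun x y => ?_⟩
      have hk : ∀ a b : ZMod n, b - k = a - k + 1 ↔ b = a + 1 := fun a b => by
        rw [sub_add_eq_add_sub, sub_left_inj]
      simp [cycleArcs, r_smul_labelling, hk]
    · refine ⟨Equiv.subLeft (1 - k), fun x y => ?_⟩
      have hk : ∀ a b : ZMod n, 1 - k - b = 1 - k - a + 1 ↔ a = b + 1 := fun a b =>
        ⟨fun h => by linear_combination h, fun h => by linear_combination h⟩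
      have hx : ∀ a : ZMod n, 1 - k - (a + 1) = -k - a := fun a => by ring
      simp only [cycleArcs, sr_smul_labelling, Equiv.subLeft_apply, hk]
      rw [or_comm]
      refine or_congr (and_congr_right ?_) (and_congr_right ?_) <;> rintro rfl <;> simp [hx]

theorem digraphIso_cycleOrientationEquiv_iff {n : ℕ} [NeZero n] (hn : 3 ≤ n)
    (f g : ZMod n → Bool) :
    DigraphIso n (cycleOrientationEquiv n hn f).1 (cycleOrientationEquiv n hn g).1 ↔
      f ∈ MulAction.orbit (DihedralGroup n) g := by
  rw [← exists_perm_cycleArcs_iff hn]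
  let e : Fin n ≃ ZMod n := (ZMod.finEquiv n).toEquiv
  refine e.permCongr.exists_congr fun σ => ?_
  refine e.forall_congr fun a => e.forall_congr fun b => ?_
  rw [Equiv.permCongr_apply, Equiv.permCongr_apply, e.symm_apply_apply, e.symm_apply_apply]
  rfl

theorem card_quotient_cycleOrientSetoid {n : ℕ} [NeZero n] (hn : 3 ≤ n) :
    Nat.card (Quotient (cycleOrientSetoid n)) =
      Nat.card (MulAction.orbitRel.Quotient (DihedralGroup n) (ZMod n → Bool)) :=
  (Nat.card_congr (Quotient.congr (cycleOrientationEquiv n hn) fun f g =>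
    (digraphIso_cycleOrientationEquiv_iff hn f g).symm)).symm

/-- For `n ≥ 3`, the number `N(C_n)` of isomorphism classes of directed
graphs whose underlying undirected graph is the cycle graph on `n` vertices satisfies
`N(C_n) = (1/(2n)) Σ_{d∣n} 2^{n/d} φ(d)` for odd `n` and
`N(C_n) = (1/(2n)) Σ_{d∣n} 2^{n/d} φ(d) + 2^{n/2−2}` for even `n` (stated here multiplied
through by `2n` to avoid division). -/
theorem count_cycle_orientations (n : ℕ) (hn : 3 ≤ n) :
    (Odd n → 2 * n * Nat.card (Quotient (cycleOrientSetoid n)) =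
      ∑ d ∈ n.divisors, 2 ^ (n / d) * Nat.totient d) ∧
    (Even n → 2 * n * Nat.card (Quotient (cycleOrientSetoid n)) =
      (∑ d ∈ n.divisors, 2 ^ (n / d) * Nat.totient d) + 2 * n * 2 ^ (n / 2 - 2)) := by
  have : NeZero n := ⟨by omega⟩
  rw [card_quotient_cycleOrientSetoid hn, two_mul_card_orbits]
  refine ⟨fun h => ?_, fun h => ?_⟩
  · rw [sum_card_antiInvariant_odd n h, add_zero]
  · rw [sum_card_antiInvariant_even n h]
    obtain ⟨m, rfl⟩ : ∃ m, n = 2 * (m + 2) := by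
      obtain ⟨j, rfl⟩ := h
      exact ⟨j - 2, by omega⟩
    rw [Nat.mul_div_cancel_left _ two_pos, Nat.add_sub_cancel]
    ring
end

section
/- For n ≥ 1, the number of isomorphism classes of finite posets on n elements whose Hasse digraph is an oriented path (equivalently, by the classification, of connected positive posets of Dynkin type A_n) equals 2^{n−2} if n is even, and 2^{(n−3)/2} + 2^{n−2} if n is odd (interpreting the formula as 1 when n = 1). -/
/-- The Hasse (covering) relation of the order `le`: `i → j` iff `i ⪯ j`, `i ≠ j`,
and no third element lies strictly between them. -/
def hasseRel (n : ℕ) (le : Fin n → Fin n → Prop) (i j : Fin n) : Prop :=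
  le i j ∧ i ≠ j ∧ ∀ k, le i k → le k j → k = i ∨ k = j

/-- Two relations on `Fin n` are isomorphic if some bijection of the underlying set carries
one onto the other; for partial orders this is exactly order-isomorphism of the posets. -/
def RelIso' (n : ℕ) (A B : Fin n → Fin n → Prop) : Prop :=
  ∃ σ : Equiv.Perm (Fin n), ∀ a b, A a b ↔ B (σ a) (σ b)

theorem relIso'_equivalence (n : ℕ) : Equivalence (RelIso' n) := by
  constructor
  · exact fun A => ⟨Equiv.refl _, fun a b => Iff.rfl⟩
  · rintro A B ⟨σ, hσ⟩
    exact ⟨σ.symm, fun a b => by simpa using (hσ (σ.symm a) (σ.symm b)).symm⟩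
  · rintro A B C ⟨σ, hσ⟩ ⟨τ, hτ⟩
    exact ⟨σ.trans τ, fun a b => (hσ a b).trans (hτ (σ a) (σ b))⟩

/-- A partial order on `Fin n` whose Hasse digraph is an oriented path, i.e. the underlying
undirected graph of the Hasse digraph is (isomorphic to) the path graph on `n` vertices. -/
def IsOrientedPathPoset (n : ℕ) (le : Fin n → Fin n → Prop) : Prop :=
  IsPartialOrder (Fin n) le ∧
    Nonempty (SimpleGraph.fromRel (hasseRel n le) ≃g SimpleGraph.pathGraph n)

/-- The setoid of posets on `n` points whose Hasse digraph is an oriented path, up to poset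
isomorphism. -/
def orientedPathPosetSetoid (n : ℕ) :
    Setoid {le : Fin n → Fin n → Prop // IsOrientedPathPoset n le} :=
  ⟨fun A B => RelIso' n A.1 B.1,
    ⟨fun A => (relIso'_equivalence n).refl A.1,
      fun h => (relIso'_equivalence n).symm h,
      fun h g => (relIso'_equivalence n).trans h g⟩⟩

open Relation in
/-- A partial order on a finite type is the reflexive transitive closure of its covering
relation. -/
theorem le_iff_reflTransGen_cover {α : Type*} [Finite α] {le : α → α → Prop}
    (h : IsPartialOrder α le) (a b : α) :
    le a b ↔ ReflTransGen
      (fun i j => le i j ∧ i ≠ j ∧ ∀ k, le i k → le k j → k = i ∨ k = j) a b := by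
  classical
  have := Fintype.ofFinite α
  let P : PartialOrder α :=
    { le := le
      le_refl := h.refl
      le_trans := h.trans
      le_antisymm := h.antisymm }
  let L : LocallyFiniteOrder α := Fintype.toLocallyFiniteOrder
  have key : ∀ i j : α, i ⋖ j ↔ i ≤ j ∧ i ≠ j ∧ ∀ k, i ≤ k → k ≤ j → k = i ∨ k = j := by
    intro i j
    constructor
    · exact fun hij => ⟨hij.le, hij.ne, fun k => hij.eq_or_eq⟩
    · rintro ⟨hle, hne, hk⟩
      refine ⟨lt_of_le_of_ne hle hne, fun c hic hcj => ?_⟩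
      rcases hk c hic.le hcj.le with rfl | rfl
      · exact lt_irrefl _ hic
      · exact lt_irrefl _ hcj
  have := le_iff_reflTransGen_covBy (x := a) (y := b)
  simp only [key] at this
  exact this

theorem hasseRel_asymm {n : ℕ} {le : Fin n → Fin n → Prop} (h : IsPartialOrder (Fin n) le)
    {i j : Fin n} (hij : hasseRel n le i j) : ¬ hasseRel n le j i :=
  fun hji => hij.2.1 (h.antisymm i j hij.1 hji.1)

/-- A bijection that preserves the Hasse digraphs of two partial orders is an isomorphism. -/
theorem le_iff_of_hasseRel_iff {n : ℕ} {A B : Fin n → Fin n → Prop}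
    (hA : IsPartialOrder (Fin n) A) (hB : IsPartialOrder (Fin n) B) (σ : Equiv.Perm (Fin n))
    (h : ∀ a b, hasseRel n A a b ↔ hasseRel n B (σ a) (σ b)) (a b : Fin n) :
    A a b ↔ B (σ a) (σ b) := by
  rw [le_iff_reflTransGen_cover hA, le_iff_reflTransGen_cover hB]
  constructor
  · exact fun hab => Relation.ReflTransGen.lift σ (fun i j => (h i j).1) _ _ hab
  · intro hab
    have := Relation.ReflTransGen.lift (r := hasseRel n B) (p := hasseRel n A) σ.symm
      (fun i j hij => (h _ _).2 (by simpa using hij)) _ _ hab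
    rwa [Function.onFun, σ.symm_apply_apply, σ.symm_apply_apply] at this

theorem hasseRel_iff_of_le_iff {n : ℕ} {A B : Fin n → Fin n → Prop} (σ : Equiv.Perm (Fin n))
    (h : ∀ a b, A a b ↔ B (σ a) (σ b)) (a b : Fin n) :
    hasseRel n A a b ↔ hasseRel n B (σ a) (σ b) := by
  simp only [hasseRel, h, ne_eq, EmbeddingLike.apply_eq_iff_eq, ← σ.forall_congr_right (q :=
    fun k => B (σ a) k → B k (σ b) → k = σ a ∨ k = σ b)]

/-- The order on the vertices of a path whose edge `{k, k + 1}` points upwards when `ε k` is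
true and downwards otherwise. -/
def pathLE {m : ℕ} (ε : Fin m → Bool) (i j : Fin (m + 1)) : Prop :=
  (i.val ≤ j.val ∧ ∀ k : Fin m, i.val ≤ k.val → k.val < j.val → ε k = true) ∨
    (j.val ≤ i.val ∧ ∀ k : Fin m, j.val ≤ k.val → k.val < i.val → ε k = false)

theorem isPartialOrder_pathLE {m : ℕ} (ε : Fin m → Bool) :
    IsPartialOrder (Fin (m + 1)) (pathLE ε) where
  refl i := Or.inl ⟨le_rfl, fun k h h' => by omega⟩
  trans a b c := by
    rintro (⟨h, h1⟩ | ⟨h, h1⟩) (⟨h', h2⟩ | ⟨h', h2⟩)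
    · exact Or.inl ⟨by omega, fun k _ _ => by
        by_cases k.val < b.val
        · exact h1 k (by omega) (by omega)
        · exact h2 k (by omega) (by omega)⟩
    · rcases Nat.eq_or_lt_of_le h with e | e
      · exact Or.inr ⟨by omega, fun k _ _ => h2 k (by omega) (by omega)⟩
      · rcases Nat.eq_or_lt_of_le h' with e' | e'
        · exact Or.inl ⟨by omega, fun k _ _ => h1 k (by omega) (by omega)⟩
        · have := h1 ⟨b.val - 1, by omega⟩ (by simp only; omega) (by simp only; omega)
          have := h2 ⟨b.val - 1, by omega⟩ (by simp only; omega) (by simp only; omega)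
          simp_all
    · rcases Nat.eq_or_lt_of_le h with e | e
      · exact Or.inl ⟨by omega, fun k _ _ => h2 k (by omega) (by omega)⟩
      · rcases Nat.eq_or_lt_of_le h' with e' | e'
        · exact Or.inr ⟨by omega, fun k _ _ => h1 k (by omega) (by omega)⟩
        · have := h1 ⟨b.val, by omega⟩ (by simp only; omega) (by simp only; omega)
          have := h2 ⟨b.val, by omega⟩ (by simp only; omega) (by simp only; omega)
          simp_all
    · exact Or.inr ⟨by omega, fun k _ _ => by
        by_cases k.val < b.val
        · exact h2 k (by omega) (by omega)
        · exact h1 k (by omega) (by omega)⟩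
  antisymm a b := by
    rintro (⟨h, h1⟩ | ⟨h, h1⟩) (⟨h', h2⟩ | ⟨h', h2⟩)
    · exact Fin.ext (by omega)
    · by_contra hne
      have : a.val ≠ b.val := fun e => hne (Fin.ext e)
      have := h1 ⟨a.val, by omega⟩ (by simp only; omega) (by simp only; omega)
      have := h2 ⟨a.val, by omega⟩ (by simp only; omega) (by simp only; omega)
      simp_all
    · by_contra hne
      have : a.val ≠ b.val := fun e => hne (Fin.ext e)
      have := h1 ⟨b.val, by omega⟩ (by simp only; omega) (by simp only; omega)
      have := h2 ⟨b.val, by omega⟩ (by simp only; omega) (by simp only; omega)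
      simp_all
    · exact Fin.ext (by omega)

theorem hasseRel_pathLE {m : ℕ} (ε : Fin m → Bool) (i j : Fin (m + 1)) :
    hasseRel (m + 1) (pathLE ε) i j ↔
      ∃ k : Fin m, (i = k.castSucc ∧ j = k.succ ∧ ε k = true) ∨
        (j = k.castSucc ∧ i = k.succ ∧ ε k = false) := by
  constructor
  · rintro ⟨⟨h, h1⟩ | ⟨h, h1⟩, hne, hk⟩
    · have hne' : i.val ≠ j.val := fun e => hne (Fin.ext e)
      have hs : j.val = i.val + 1 := by
        have := hk ⟨i.val + 1, by omega⟩
          (Or.inl ⟨by simp only; omega, fun k _ h' => h1 k (by omega) (by simp only at h'; omega)⟩)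
          (Or.inl ⟨by simp only; omega, fun k h' _ => h1 k (by simp only at h'; omega) (by omega)⟩)
        simp only [Fin.ext_iff] at this
        omega
      exact ⟨⟨i.val, by omega⟩, Or.inl ⟨rfl, Fin.ext hs, h1 _ le_rfl (by simp only; omega)⟩⟩
    · have hne' : i.val ≠ j.val := fun e => hne (Fin.ext e)
      have hs : i.val = j.val + 1 := by
        have := hk ⟨j.val + 1, by omega⟩
          (Or.inr ⟨by simp only; omega, fun k h' _ => h1 k (by simp only at h'; omega) (by omega)⟩)
          (Or.inr ⟨by simp only; omega, fun k _ h' => h1 k (by omega) (by simp only at h'; omega)⟩)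
        simp only [Fin.ext_iff] at this
        omega
      exact ⟨⟨j.val, by omega⟩, Or.inr ⟨rfl, Fin.ext hs, h1 _ le_rfl (by simp only; omega)⟩⟩
  · rintro ⟨k, ⟨rfl, rfl, hk⟩ | ⟨rfl, rfl, hk⟩⟩
    · refine ⟨Or.inl ⟨by simp, fun l h h' => ?_⟩, by simp [Fin.ext_iff], fun l h h' => ?_⟩
      · rwa [show l = k from Fin.ext (by simp at h h'; omega)]
      · by_contra! hl
        simp only [ne_eq, Fin.ext_iff, Fin.val_castSucc, Fin.val_succ] at hl
        rcases h with ⟨h, h1⟩ | ⟨h, h1⟩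
        · rcases h' with ⟨h', h2⟩ | ⟨h', h2⟩
          · simp at h h'; omega
          · have := h2 ⟨k.val + 1, by simp at h h'; omega⟩ (by simp) (by simp at h h' ⊢; omega)
            have := h1 ⟨k.val + 1, by simp at h h'; omega⟩ (by simp) (by simp at h h' ⊢; omega)
            simp_all
        · have := h1 ⟨l.val, by simp at h; omega⟩ (by simp) (by simp at h ⊢; omega)
          rcases h' with ⟨h', h2⟩ | ⟨h', h2⟩
          · have := h2 ⟨l.val, by simp at h; omega⟩ (by simp) (by simp at h h' ⊢; omega)
            simp_all
          · simp at h h'; omega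
    · refine ⟨Or.inr ⟨by simp, fun l h h' => ?_⟩, by simp [Fin.ext_iff], fun l h h' => ?_⟩
      · rwa [show l = k from Fin.ext (by simp at h h'; omega)]
      · by_contra! hl
        simp only [ne_eq, Fin.ext_iff, Fin.val_castSucc, Fin.val_succ] at hl
        rcases h with ⟨h, h1⟩ | ⟨h, h1⟩
        · have := h1 ⟨k.val + 1, by simp at h; omega⟩ (by simp) (by simp at h ⊢; omega)
          rcases h' with ⟨h', h2⟩ | ⟨h', h2⟩
          · simp at h h'; omega
          · have := h2 ⟨k.val + 1, by simp at h; omega⟩ (by simp) (by simp at h h' ⊢; omega)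
            simp_all
        · rcases h' with ⟨h', h2⟩ | ⟨h', h2⟩
          · have := h1 ⟨l.val, by simp at h h'; omega⟩ (by simp) (by simp at h h' ⊢; omega)
            have := h2 ⟨l.val, by simp at h h'; omega⟩ (by simp) (by simp at h h' ⊢; omega)
            simp_all
          · simp at h h'; omega

theorem isOrientedPathPoset_pathLE {m : ℕ} (ε : Fin m → Bool) :
    IsOrientedPathPoset (m + 1) (pathLE ε) := by
  refine ⟨isPartialOrder_pathLE ε, ⟨⟨Equiv.refl _, fun {a b} => ?_⟩⟩⟩
  simp only [Equiv.refl_apply, SimpleGraph.pathGraph_adj, SimpleGraph.fromRel_adj,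
    hasseRel_pathLE]
  constructor
  · rintro (h | h)
    · refine ⟨fun e => by simp [e] at h, ?_⟩
      cases he : ε ⟨a.val, by omega⟩
      · exact Or.inr ⟨⟨a.val, by omega⟩, Or.inr ⟨rfl, Fin.ext h.symm, he⟩⟩
      · exact Or.inl ⟨⟨a.val, by omega⟩, Or.inl ⟨rfl, Fin.ext h.symm, he⟩⟩
    · refine ⟨fun e => by simp [e] at h, ?_⟩
      cases he : ε ⟨b.val, by omega⟩
      · exact Or.inl ⟨⟨b.val, by omega⟩, Or.inr ⟨rfl, Fin.ext h.symm, he⟩⟩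
      · exact Or.inr ⟨⟨b.val, by omega⟩, Or.inl ⟨rfl, Fin.ext h.symm, he⟩⟩
  · rintro ⟨-, ⟨k, ⟨rfl, rfl, -⟩ | ⟨rfl, rfl, -⟩⟩ | ⟨k, ⟨rfl, rfl, -⟩ | ⟨rfl, rfl, -⟩⟩⟩ <;> simp

theorem exists_relIso_pathLE {m : ℕ} {le : Fin (m + 1) → Fin (m + 1) → Prop}
    (h : IsOrientedPathPoset (m + 1) le) : ∃ ε : Fin m → Bool, RelIso' (m + 1) (pathLE ε) le := by
  classical
  obtain ⟨hle, ⟨φ⟩⟩ := h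
  have adj (k : Fin m) : hasseRel (m + 1) le (φ.symm k.castSucc) (φ.symm k.succ) ∨
      hasseRel (m + 1) le (φ.symm k.succ) (φ.symm k.castSucc) := by
    have : (SimpleGraph.fromRel (hasseRel (m + 1) le)).Adj (φ.symm k.castSucc)
        (φ.symm k.succ) := φ.symm.map_adj_iff.2 (by simp [SimpleGraph.pathGraph_adj])
    exact ((SimpleGraph.fromRel_adj _ _ _).1 this).2
  let ε : Fin m → Bool := fun k =>
    decide (hasseRel (m + 1) le (φ.symm k.castSucc) (φ.symm k.succ))
  refine ⟨ε, φ.toEquiv.symm,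
    le_iff_of_hasseRel_iff (isPartialOrder_pathLE ε) hle φ.toEquiv.symm fun a b => ?_⟩
  change _ ↔ hasseRel (m + 1) le (φ.symm a) (φ.symm b)
  rw [hasseRel_pathLE]
  constructor
  · rintro ⟨k, ⟨rfl, rfl, hk⟩ | ⟨rfl, rfl, hk⟩⟩
    · exact of_decide_eq_true hk
    · exact (adj k).resolve_left (of_decide_eq_false hk)
  · intro hab
    have : (SimpleGraph.pathGraph (m + 1)).Adj a b :=
      φ.symm.map_adj_iff.1 ((SimpleGraph.fromRel_adj _ _ _).2 ⟨hab.2.1, Or.inl hab⟩)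
    rcases SimpleGraph.pathGraph_adj.1 this with e | e
    · obtain ⟨k, rfl, rfl⟩ : ∃ k : Fin m, a = k.castSucc ∧ b = k.succ :=
        ⟨⟨a.val, by omega⟩, rfl, Fin.ext e.symm⟩
      exact ⟨k, Or.inl ⟨rfl, rfl, decide_eq_true hab⟩⟩
    · obtain ⟨k, rfl, rfl⟩ : ∃ k : Fin m, b = k.castSucc ∧ a = k.succ :=
        ⟨⟨b.val, by omega⟩, rfl, Fin.ext e.symm⟩
      exact ⟨k, Or.inr ⟨rfl, rfl, decide_eq_false (hasseRel_asymm hle hab)⟩⟩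

/-- The path graph has no automorphisms besides the identity and the reversal. -/
theorem eq_refl_or_eq_revPerm_of_adj {m : ℕ} (σ : Equiv.Perm (Fin (m + 1)))
    (h : ∀ k : Fin m, (σ k.castSucc).val + 1 = (σ k.succ).val ∨
      (σ k.succ).val + 1 = (σ k.castSucc).val) :
    σ = Equiv.refl _ ∨ σ = Fin.revPerm := by
  rcases m with _ | m
  · exact Or.inl (Equiv.ext fun i => Subsingleton.elim (α := Fin 1) _ _)
  let f : ℕ → ℕ := fun i => if hi : i < m + 2 then (σ ⟨i, hi⟩).val else 0
  have hf (i : ℕ) (hi : i < m + 2) : f i = (σ ⟨i, hi⟩).val := dif_pos hi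
  have step (i : ℕ) (hi : i < m + 1) : f i + 1 = f (i + 1) ∨ f (i + 1) + 1 = f i := by
    rw [hf i (by omega), hf (i + 1) (by omega)]
    exact h ⟨i, hi⟩
  have inj (i : ℕ) (hi : i < m) : f i ≠ f (i + 2) := by
    rw [hf i (by omega), hf (i + 2) (by omega)]
    intro e
    have := σ.injective (Fin.ext e)
    simp at this
  have bound (i : ℕ) (hi : i < m + 2) : f i < m + 2 := by
    rw [hf i hi]; exact (σ _).isLt
  rcases step 0 (by omega) with h0 | h0
  · left
    have up (i : ℕ) : i < m + 1 → f i + 1 = f (i + 1) := by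
      induction i with
      | zero => exact fun _ => h0
      | succ i ih =>
        intro hi
        have := ih (by omega)
        have := step (i + 1) hi
        have := inj i (by omega)
        grind
    have lin (i : ℕ) : i < m + 2 → f i = f 0 + i := by
      induction i with
      | zero => simp
      | succ i ih => intro hi; have := up i (by omega); have := ih (by omega); omega
    ext i
    have := lin i i.isLt
    have := lin (m + 1) (by omega)
    have := bound (m + 1) (by omega)
    have := hf i i.isLt
    simp only [Fin.eta] at this
    rw [Equiv.refl_apply]
    omega
  · right
    have down (i : ℕ) : i < m + 1 → f (i + 1) + 1 = f i := by
      induction i with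
      | zero => exact fun _ => h0
      | succ i ih =>
        intro hi
        have := ih (by omega)
        have := step (i + 1) hi
        have := inj i (by omega)
        grind
    have lin (i : ℕ) : i < m + 2 → f i + i = f 0 := by
      induction i with
      | zero => simp
      | succ i ih => intro hi; have := down i (by omega); have := ih (by omega); omega
    ext i
    have := lin i i.isLt
    have := lin (m + 1) (by omega)
    have := bound 0 (by omega)
    have := hf i i.isLt
    simp only [Fin.eta] at this
    rw [Fin.revPerm_apply, Fin.val_rev]
    omega

/-- The orientation obtained by reading an oriented path backwards. -/
def reverseOrientation {m : ℕ} (ε : Fin m → Bool) : Fin m → Bool := fun k => !ε k.rev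

theorem relIso_pathLE_iff {m : ℕ} (ε δ : Fin m → Bool) :
    RelIso' (m + 1) (pathLE ε) (pathLE δ) ↔ ε = δ ∨ ε = reverseOrientation δ := by
  constructor
  · rintro ⟨σ, hσ⟩
    have hH := hasseRel_iff_of_le_iff σ hσ
    have hadj (k : Fin m) : hasseRel (m + 1) (pathLE ε) k.castSucc k.succ ∨
        hasseRel (m + 1) (pathLE ε) k.succ k.castSucc := by
      simp only [hasseRel_pathLE]
      cases he : ε k
      · exact Or.inr ⟨k, Or.inr ⟨rfl, rfl, he⟩⟩
      · exact Or.inl ⟨k, Or.inl ⟨rfl, rfl, he⟩⟩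
    have val (k : Fin m) : ε k = true ↔ hasseRel (m + 1) (pathLE ε) k.castSucc k.succ := by
      rw [hasseRel_pathLE]
      constructor
      · exact fun he => ⟨k, Or.inl ⟨rfl, rfl, he⟩⟩
      · rintro ⟨l, ⟨h, -, hl⟩ | ⟨h, h', -⟩⟩
        · rwa [Fin.castSucc_injective _ h]
        · simp [Fin.ext_iff] at h h'; omega
    have hσ' := eq_refl_or_eq_revPerm_of_adj σ fun k => by
      rcases hadj k with h | h <;> rw [hH, hasseRel_pathLE] at h <;>
        obtain ⟨l, ⟨h1, h2, -⟩ | ⟨h1, h2, -⟩⟩ := h <;> simp [h1, h2]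
    rcases hσ' with rfl | rfl
    · left
      funext k
      rw [Bool.eq_iff_iff, val, hH, hasseRel_pathLE]
      constructor
      · rintro ⟨l, ⟨h, -, hl⟩ | ⟨h, h', -⟩⟩
        · rwa [Fin.castSucc_injective _ h]
        · simp [Fin.ext_iff] at h h'; omega
      · exact fun he => ⟨k, Or.inl ⟨rfl, rfl, he⟩⟩
    · right
      funext k
      rw [Bool.eq_iff_iff, val, hH, hasseRel_pathLE]
      simp only [Fin.revPerm_apply, Fin.rev_castSucc, Fin.rev_succ, reverseOrientation,
        Bool.not_eq_true']
      constructor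
      · rintro ⟨l, ⟨h, h', -⟩ | ⟨h, -, hl⟩⟩
        · simp [Fin.ext_iff] at h h'; omega
        · rwa [Fin.castSucc_injective _ h]
      · exact fun he => ⟨k.rev, Or.inr ⟨rfl, rfl, he⟩⟩
  · rintro (rfl | rfl)
    · exact (relIso'_equivalence _).refl _
    · refine ⟨Fin.revPerm, le_iff_of_hasseRel_iff (isPartialOrder_pathLE _)
        (isPartialOrder_pathLE _) _ fun a b => ?_⟩
      simp only [hasseRel_pathLE, ← (Fin.revPerm (n := m)).exists_congr_right (q := fun k =>
        (Fin.revPerm a = k.castSucc ∧ Fin.revPerm b = k.succ ∧ δ k = true) ∨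
        (Fin.revPerm b = k.castSucc ∧ Fin.revPerm a = k.succ ∧ δ k = false))]
      refine exists_congr fun k => ?_
      simp only [Fin.revPerm_apply, ← Fin.rev_succ, ← Fin.rev_castSucc, Fin.rev_inj,
        reverseOrientation, Bool.not_eq_true', Bool.not_eq_false']
      tauto

/-- Orbit counting for an involution. -/
theorem card_add_card_fixed_eq_two_mul_card {α β : Type*} [Finite α] (f : α → α) (g : α → β)
    (hf : Function.Involutive f) (hg : Function.Surjective g)
    (h : ∀ a b, g a = g b ↔ a = b ∨ a = f b) :
    Nat.card α + Nat.card {a // f a = a} = 2 * Nat.card β := by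
  classical
  have := Fintype.ofFinite α
  have := Fintype.ofSurjective g hg
  simp only [Nat.card_eq_fintype_card, Fintype.card_subtype]
  rw [← Finset.card_univ, Finset.card_eq_sum_card_fiberwise (f := g) (t := Finset.univ) (by simp),
    Finset.card_eq_sum_card_fiberwise (f := g) (s := Finset.univ.filter _) (t := Finset.univ)
      (by simp), ← Finset.sum_add_distrib, mul_comm, ← Finset.card_univ, ← smul_eq_mul,
    ← Finset.sum_const]
  refine Finset.sum_congr rfl fun b _ => ?_
  obtain ⟨a, rfl⟩ := hg b
  have fiber : (Finset.univ.filter fun x => g x = g a) = {a, f a} := by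
    ext x
    simp [h]
  rw [Finset.filter_filter]
  by_cases hfa : f a = a
  · have : (Finset.univ.filter fun x => f x = x ∧ g x = g a) = {a} := by
      ext x
      simp only [Finset.mem_filter, Finset.mem_univ, true_and, Finset.mem_singleton, h]
      grind
    rw [fiber, this, hfa]
    simp
  · have : (Finset.univ.filter fun x => f x = x ∧ g x = g a) = ∅ := by
      ext x
      simp only [Finset.mem_filter, Finset.mem_univ, true_and, Finset.notMem_empty, h, iff_false]
      have := hf a
      grind
    rw [fiber, this, Finset.card_pair (Ne.symm hfa)]
    simp

theorem reverseOrientation_involutive (m : ℕ) :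
    Function.Involutive (reverseOrientation (m := m)) := fun ε => by
  funext k
  simp [reverseOrientation]

/-- An orientation of an even path that is invariant under reversal is determined by its first
half. -/
def fixedReverseOrientationEquiv (p : ℕ) :
    {ε : Fin (2 * p) → Bool // reverseOrientation ε = ε} ≃ (Fin p → Bool) where
  toFun ε := fun k => ε.1 ⟨k.val, by omega⟩
  invFun g := ⟨fun k => if hk : k.val < p then g ⟨k.val, hk⟩ else
    !g ⟨2 * p - 1 - k.val, by omega⟩, by
      funext k
      simp only [reverseOrientation, Fin.val_rev]
      split_ifs with h h'
      · omega
      · simp only [Bool.not_inj_iff]; congr 2; omega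
      · simp only [Bool.not_not]; congr 2; omega
      · omega⟩
  left_inv ε := by
    ext k
    simp only
    split_ifs with h
    · rfl
    · conv_rhs => rw [← ε.2]
      simp only [reverseOrientation]
      rw [show k.rev = ⟨2 * p - 1 - k.val, by omega⟩ from
        Fin.ext (by simp only [Fin.val_rev]; omega)]
  right_inv g := by
    funext k
    simp

theorem isEmpty_fixed_reverseOrientation (p : ℕ) :
    IsEmpty {ε : Fin (2 * p + 1) → Bool // reverseOrientation ε = ε} := by
  refine ⟨fun ε => ?_⟩
  have := congrFun ε.2 ⟨p, by omega⟩
  rw [reverseOrientation, show Fin.rev (⟨p, by omega⟩ : Fin (2 * p + 1)) = ⟨p, by omega⟩ from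
    Fin.ext (by simp only [Fin.val_rev]; omega)] at this
  simp at this

theorem two_pow_add_card_fixed_eq (m : ℕ) :
    2 ^ m + Nat.card {ε : Fin m → Bool // reverseOrientation ε = ε} =
      2 * Nat.card (Quotient (orientedPathPosetSetoid (m + 1))) := by
  rw [← card_add_card_fixed_eq_two_mul_card reverseOrientation
    (fun ε : Fin m → Bool => (⟦⟨pathLE ε, isOrientedPathPoset_pathLE ε⟩⟧ :
      Quotient (orientedPathPosetSetoid (m + 1)))) (reverseOrientation_involutive m)]
  · simp
  · intro q
    induction q using Quotient.inductionOn with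
    | h A =>
      obtain ⟨ε, hε⟩ := exists_relIso_pathLE A.2
      exact ⟨ε, Quotient.sound hε⟩
  · exact fun ε δ => Quotient.eq.trans (relIso_pathLE_iff ε δ)

/-- For `n ≥ 1`, the number of isomorphism classes of posets on `n` elements
whose Hasse digraph is an oriented path (i.e. connected positive posets of Dynkin type `A_n`)
equals `2^{n−2}` for even `n` and `2^{(n−3)/2} + 2^{n−2}` for odd `n` (interpreted as `1` for
`n = 1`). -/
theorem count_oriented_path_posets (n : ℕ) (hn : 1 ≤ n) :
    Nat.card (Quotient (orientedPathPosetSetoid n)) =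
      if n = 1 then 1
      else if Even n then 2 ^ (n - 2)
      else 2 ^ ((n - 3) / 2) + 2 ^ (n - 2) := by
  obtain ⟨m, rfl⟩ : ∃ m, n = m + 1 := ⟨n - 1, by omega⟩
  have key := two_pow_add_card_fixed_eq m
  rcases Nat.even_or_odd' m with ⟨p, rfl | rfl⟩
  · rw [Nat.card_congr (fixedReverseOrientationEquiv p)] at key
    simp only [Nat.card_eq_fintype_card (α := Fin p → Bool), Fintype.card_fun, Fintype.card_bool,
      Fintype.card_fin] at key
    rcases p with _ | p
    · simp at key ⊢
      omega
    · rw [if_neg (by omega), if_neg (by simp [parity_simps]),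
        show (2 * (p + 1) + 1 - 3) / 2 = p by omega, show 2 * (p + 1) + 1 - 2 = 2 * p + 1 by omega]
      rw [show 2 * (p + 1) = 2 * p + 1 + 1 by ring, pow_succ 2 (2 * p + 1), pow_succ 2 p] at key
      rw [show 2 * (p + 1) + 1 = 2 * p + 1 + 1 + 1 by ring]
      omega
  · have := isEmpty_fixed_reverseOrientation p
    rw [Nat.card_of_isEmpty, pow_succ] at key
    rw [if_neg (by omega), if_pos (by simp [parity_simps]),
      show 2 * p + 1 + 1 - 2 = 2 * p by omega]
    omega
end
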